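/- (Theorem 2.) For every integer K ≥ 2 there exist a (K+1) × (K+1) real matrix A and a K-sparse vector x ∈ ℝ^{K+1} such that: (i) the restricted isometry constant of A of order K+1 equals 1/√K, i.e., (1 − 1/√K)‖z‖₂² ≤ ‖Az‖₂² ≤ (1 + 1/√K)‖z‖₂² for all z ∈ ℝ^{K+1} and no smaller constant has this property; and (ii) the maximum of i ↦ |⟨A e_i, A x⟩| over i ∈ {1, …, K+1} is attained at an index outside the support of x, so Orthogonal Matching Pursuit can fail to recover x from A x in K iterations. -/

import Mathlib

open scoped BigOperators

/-- Euclidean dot product on `Fin m → ℝ`. -/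
def dotp {m : ℕ} (u v : Fin m → ℝ) : ℝ := ∑ i, u i * v i

/-- The matrix with first row `(√(1 - 1/K), 0, …, 0)` and remaining rows `(1/K, e_i)`. Its Gram
matrix has unit diagonal, entries `1/K` between the first and any other index, and zeros elsewhere. -/
noncomputable def arrowMatrix (K : ℕ) : Matrix (Fin (K + 1)) (Fin (K + 1)) ℝ :=
  Matrix.of (Fin.cons (Fin.cons (√(1 - 1 / K)) 0)
    (fun i => Fin.cons (1 / K : ℝ) (Pi.single i 1)))

lemma arrowMatrix_mulVec_zero (K : ℕ) (z : Fin (K + 1) → ℝ) :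
    (arrowMatrix K).mulVec z 0 = √(1 - 1 / K) * z 0 := by
  simp [arrowMatrix, Matrix.mulVec, dotProduct, Fin.sum_univ_succ]

lemma arrowMatrix_mulVec_succ (K : ℕ) (z : Fin (K + 1) → ℝ) (i : Fin K) :
    (arrowMatrix K).mulVec z i.succ = 1 / K * z 0 + z i.succ := by
  simp [arrowMatrix, Matrix.mulVec, dotProduct, Fin.sum_univ_succ, Pi.single_apply]

lemma sum_sq_arrowMatrix_mulVec {K : ℕ} (hK : 0 < K) (z : Fin (K + 1) → ℝ) :
    ∑ j, (arrowMatrix K).mulVec z j ^ 2 =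
      ∑ i, z i ^ 2 + 2 / K * z 0 * ∑ i : Fin K, z i.succ := by
  have hK1 : (1 : ℝ) ≤ K := by exact_mod_cast hK
  have hpos : (0 : ℝ) ≤ 1 - 1 / K := by
    rw [sub_nonneg, div_le_one (by linarith)]
    exact hK1
  simp only [Fin.sum_univ_succ, arrowMatrix_mulVec_zero, arrowMatrix_mulVec_succ, mul_pow,
    Real.sq_sqrt hpos, add_sq, Finset.sum_add_distrib, Finset.sum_const, Finset.card_univ,
    Fintype.card_fin, nsmul_eq_mul, ← Finset.mul_sum]
  field_simp
  ring

/-- The cross term in `sum_sq_arrowMatrix_mulVec` is at most `‖z‖² / √K` in absolute value. -/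
lemma abs_cross_term_le {K : ℕ} (hK : 0 < K) (z : Fin (K + 1) → ℝ) :
    |2 / K * z 0 * ∑ i : Fin K, z i.succ| ≤ 1 / √K * ∑ i, z i ^ 2 := by
  have hK0 : (0 : ℝ) < K := by exact_mod_cast hK
  have hs : 0 < √(K : ℝ) := Real.sqrt_pos.mpr hK0
  have hsq : √(K : ℝ) ^ 2 = K := Real.sq_sqrt hK0.le
  have hcs : (∑ i : Fin K, z i.succ) ^ 2 ≤ K * ∑ i : Fin K, z i.succ ^ 2 := by
    simpa using sq_sum_le_card_mul_sum_sq (s := Finset.univ) (f := fun i : Fin K => z i.succ)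
  rw [Fin.sum_univ_succ]
  generalize (∑ i : Fin K, z i.succ) = S at *
  generalize (∑ i : Fin K, z i.succ ^ 2) = Q at *
  generalize √(K : ℝ) = s at *
  rw [← hsq] at hcs ⊢
  have hdiv : (S / s) ^ 2 ≤ Q := by
    rw [div_pow, div_le_iff₀ (by positivity)]
    linarith
  have hcross : 2 / s ^ 2 * z 0 * S = 1 / s * (2 * z 0 * (S / s)) := by
    field_simp
  rw [hcross, abs_mul, abs_of_pos (by positivity : 0 < 1 / s)]
  gcongr
  rw [abs_le]
  constructor
  · nlinarith [sq_nonneg (z 0 + S / s)]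
  · nlinarith [sq_nonneg (z 0 - S / s)]

/-- Pairing with the image of `(0, 1, …, 1)` computes the coordinate sum. -/
lemma dotp_arrowMatrix_mulVec_ones {K : ℕ} (hK : 0 < K) (u : Fin (K + 1) → ℝ) :
    dotp ((arrowMatrix K).mulVec u) ((arrowMatrix K).mulVec (Fin.cons 0 1)) = ∑ i, u i := by
  have hK0 : (K : ℝ) ≠ 0 := by exact_mod_cast hK.ne'
  simp only [dotp, Fin.sum_univ_succ, arrowMatrix_mulVec_zero, arrowMatrix_mulVec_succ]
  simp [Finset.sum_add_distrib, hK0]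

/-- Theorem 2: for every `K ≥ 2` there exist a `(K+1) × (K+1)` matrix `A`
and a `K`-sparse vector `x` such that (i) the restricted isometry constant of `A` of order
`K+1` equals `1/√K`: the RIP inequalities hold with `δ = 1/√K` for all `z ∈ ℝ^{K+1}` and
fail for every smaller `δ`; and (ii) the maximum of `i ↦ |⟨A e_i, A x⟩|` is attained at an
index outside the support of `x`, so OMP can fail to recover `x` from `A x` in `K`
iterations. -/
theorem stmt10 (K : ℕ) (hK : 2 ≤ K) :
    ∃ (A : Matrix (Fin (K + 1)) (Fin (K + 1)) ℝ) (x : Fin (K + 1) → ℝ),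
      {i | x i ≠ 0}.ncard ≤ K ∧
      (∀ z : Fin (K + 1) → ℝ,
          (1 - 1 / Real.sqrt K) * (∑ i, z i ^ 2) ≤ ∑ j, (A.mulVec z) j ^ 2 ∧
            ∑ j, (A.mulVec z) j ^ 2 ≤ (1 + 1 / Real.sqrt K) * (∑ i, z i ^ 2)) ∧
      (∀ δ : ℝ, δ < 1 / Real.sqrt K →
          ¬ (∀ z : Fin (K + 1) → ℝ,
              (1 - δ) * (∑ i, z i ^ 2) ≤ ∑ j, (A.mulVec z) j ^ 2 ∧
                ∑ j, (A.mulVec z) j ^ 2 ≤ (1 + δ) * (∑ i, z i ^ 2))) ∧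
      ∃ j : Fin (K + 1), x j = 0 ∧
        ∀ i : Fin (K + 1),
          |dotp (A.mulVec (Pi.single i 1)) (A.mulVec x)| ≤
            |dotp (A.mulVec (Pi.single j 1)) (A.mulVec x)| := by
  have hK' : 0 < K := by omega
  have hK0 : (0 : ℝ) < K := by exact_mod_cast hK'
  refine ⟨arrowMatrix K, Fin.cons 0 1, ?_, fun z => ?_, fun δ hδ h => ?_, 0, by simp, fun i => ?_⟩
  · have hsub : {i : Fin (K + 1) | (Fin.cons 0 1 : Fin (K + 1) → ℝ) i ≠ 0} ⊆
        Set.range (Fin.succ : Fin K → Fin (K + 1)) := by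
      intro i hi
      induction i using Fin.cases with
      | zero => simp at hi
      | succ i => exact ⟨i, rfl⟩
    calc _ ≤ (Set.range (Fin.succ : Fin K → Fin (K + 1))).ncard :=
          Set.ncard_le_ncard hsub (Set.toFinite _)
      _ = K := by
          rw [← Set.image_univ, Set.ncard_image_of_injective _ (Fin.succ_injective K)]
          simp
  · have hcross := abs_le.mp (abs_cross_term_le hK' z)
    rw [sum_sq_arrowMatrix_mulVec hK']
    constructor <;> linarith [hcross.1, hcross.2]
  · have hupper := (h (Fin.cons (√K) 1)).2
    rw [sum_sq_arrowMatrix_mulVec hK'] at hupper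
    have hs : 0 < √(K : ℝ) := Real.sqrt_pos.mpr hK0
    have hsq : √(K : ℝ) ^ 2 = K := Real.sq_sqrt hK0.le
    simp only [Fin.sum_univ_succ, Fin.cons_zero, Fin.cons_succ, Pi.one_apply, hsq, one_pow,
      Finset.sum_const, Finset.card_univ, Fintype.card_fin, nsmul_eq_mul, mul_one] at hupper
    have hcross : 2 / (K : ℝ) * √K * K = 1 / √K * (K + K) := by
      field_simp
      linarith
    nlinarith
  · simp only [dotp_arrowMatrix_mulVec_ones hK', Finset.sum_pi_single', Finset.mem_univ, if_true,
      le_refl]
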